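/- Let θ ∈ (0,1), let m be a positive integer that is not a power of 2, set N = 2^⌈log₂ m⌉ − m, and let δ = ρ/(2τ) where ρ, τ are positive integers with ρ ≤ τ. Then the contribution of the negative residuals to the average code-length satisfies ∫_{−∞}^{0} ℓ(ε)·f_θ(ε) dε = (1/2)(1 + ⌊log₂ m⌋) + (1/2)·(θ^(N/2)/(1 − θ^(m/2)))·θ^δ. -/

import Mathlib

open MeasureTheory

lemma integrableOn_rpow_const_left_Ioi {θ : ℝ} (hθ : θ ∈ Set.Ioo (0:ℝ) 1) (c : ℝ) :
    IntegrableOn (fun x : ℝ => θ ^ x) (Set.Ioi c) := by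
  simpa only [Real.rpow_def_of_pos hθ.1] using
    integrableOn_exp_mul_Ioi (Real.log_neg hθ.1 hθ.2) c

lemma integral_rpow_const_left_Ioi {θ : ℝ} (hθ : θ ∈ Set.Ioo (0:ℝ) 1) (c : ℝ) :
    ∫ x in Set.Ioi c, θ ^ x = -θ ^ c / Real.log θ := by
  simpa only [Real.rpow_def_of_pos hθ.1] using
    integral_exp_mul_Ioi (Real.log_neg hθ.1 hθ.2) c

lemma integral_laplace_tail {θ : ℝ} (hθ : θ ∈ Set.Ioo (0:ℝ) 1) (c : ℝ) :
    ∫ x in Set.Ioi c, (-Real.log θ / 2) * θ ^ x = θ ^ c / 2 := by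
  have hlog : Real.log θ ≠ 0 := (Real.log_neg hθ.1 hθ.2).ne
  rw [integral_const_mul, integral_rpow_const_left_Ioi hθ]
  field_simp

lemma hasSum_indicator_natCast_le (t : ℝ) :
    HasSum (fun k : ℕ => if (k : ℝ) ≤ t then (1 : ℝ) else 0)
      (if t < 0 then 0 else 1 + (⌊t⌋ : ℝ)) := by
  split_ifs with ht
  · convert hasSum_zero using 2 with k
    exact if_neg fun h => absurd (k.cast_nonneg.trans h) ht.not_ge
  · push Not at ht
    have hmem (k : ℕ) : (k : ℝ) ≤ t ↔ k ∈ Finset.range (⌊t⌋₊ + 1) := by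
      rw [Finset.mem_range, Nat.lt_succ_iff, Nat.le_floor_iff ht]
    simp only [hmem]
    have h : HasSum (fun k => if k ∈ Finset.range (⌊t⌋₊ + 1) then (1 : ℝ) else 0) _ :=
      hasSum_sum_of_ne_finset_zero fun k hk => if_neg hk
    rwa [Finset.sum_ite_mem, Finset.inter_self, Finset.sum_const, Finset.card_range,
      nsmul_eq_mul, mul_one, Nat.cast_add_one, natCast_floor_eq_intCast_floor ht,
      add_comm _ (1 : ℝ)] at h

/-- The average over one side of the Laplace density of a code-length that equals `L` plus the
number of thresholds `a + k * d`, `k : ℕ`, not exceeding `x`. -/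
lemma integral_step_mul_laplace {θ : ℝ} (hθ : θ ∈ Set.Ioo (0:ℝ) 1) (L : ℝ) (hL : 0 ≤ L)
    {a d : ℝ} (ha : 0 ≤ a) (hd : 0 < d) :
    ∫ x in Set.Ioi (0:ℝ), (L + if (x - a) / d < 0 then 0 else 1 + (⌊(x - a) / d⌋ : ℝ)) *
        ((-Real.log θ / 2) * θ ^ x)
      = L / 2 + θ ^ a / (1 - θ ^ d) / 2 := by
  set g : ℝ → ℝ := fun x => (-Real.log θ / 2) * θ ^ x
  have hg_nonneg (x : ℝ) : 0 ≤ g x :=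
    mul_nonneg (by linarith [Real.log_neg hθ.1 hθ.2]) (Real.rpow_nonneg hθ.1.le x)
  have hg_int (c : ℝ) : IntegrableOn g (Set.Ioi c) :=
    (integrableOn_rpow_const_left_Ioi hθ c).const_mul _
  obtain ⟨F, hF0, hFs⟩ : ∃ F : ℕ → ℝ → ℝ, (F 0 = fun x => L * g x) ∧
      ∀ k : ℕ, F (k + 1) = (Set.Ici (a + k * d)).indicator g :=
    ⟨fun k => k.casesOn (fun x => L * g x) fun k => (Set.Ici (a + k * d)).indicator g,
      rfl, fun _ => rfl⟩
  have hF_nonneg (k : ℕ) (x : ℝ) : 0 ≤ F k x := by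
    cases k with
    | zero => rw [hF0]; exact mul_nonneg hL (hg_nonneg x)
    | succ k => rw [hFs]; exact Set.indicator_nonneg (fun y _ => hg_nonneg y) x
  have hF_int (k : ℕ) : IntegrableOn (F k) (Set.Ioi 0) := by
    cases k with
    | zero => rw [hF0]; exact (hg_int 0).const_mul L
    | succ k => rw [hFs]; exact (hg_int 0).indicator measurableSet_Ici
  have hF_zero : ∫ x in Set.Ioi 0, F 0 x = L / 2 := by
    rw [hF0, integral_const_mul, integral_laplace_tail hθ, Real.rpow_zero, mul_one_div]
  have hF_succ (k : ℕ) : ∫ x in Set.Ioi 0, F (k + 1) x = θ ^ a / 2 * (θ ^ d) ^ k := by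
    have hc : 0 ≤ a + k * d := by positivity
    rw [hFs, ← integral_Ici_eq_integral_Ioi, setIntegral_indicator measurableSet_Ici,
      Set.inter_eq_right.2 (Set.Ici_subset_Ici.2 hc), integral_Ici_eq_integral_Ioi,
      integral_laplace_tail hθ, Real.rpow_add hθ.1, mul_comm (k : ℝ), Real.rpow_mul_natCast hθ.1.le]
    ring
  have hgeom : HasSum (fun k => ∫ x in Set.Ioi 0, F k x)
      (L / 2 + θ ^ a / (1 - θ ^ d) / 2) := by
    have h := (hasSum_geometric_of_lt_one (Real.rpow_nonneg hθ.1.le d)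
      (Real.rpow_lt_one hθ.1.le hθ.2 hd)).mul_left (θ ^ a / 2)
    simp only [← hF_succ] at h
    have h0 := HasSum.zero_add (f := fun k => ∫ x in Set.Ioi 0, F k x) h
    rw [hF_zero] at h0
    convert h0 using 1
    ring
  have hsum := hasSum_integral_of_summable_integral_norm hF_int
    (by simpa only [Real.norm_of_nonneg (hF_nonneg _ _)] using hgeom.summable)
  rw [← hsum.unique hgeom]
  refine integral_congr_ae (.of_forall fun x => ?_)
  have hpt : HasSum (fun k => F (k + 1) x)
      ((if (x - a) / d < 0 then 0 else 1 + (⌊(x - a) / d⌋ : ℝ)) * g x) := by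
    refine ((hasSum_indicator_natCast_le ((x - a) / d)).mul_right (g x)).congr_fun fun k => ?_
    simp only [hFs, Set.indicator_apply, Set.mem_Ici, le_div_iff₀ hd, le_sub_iff_add_le', ite_mul,
      one_mul, zero_mul]
  have h0 := HasSum.zero_add (f := fun k => F k x) hpt
  rw [hF0, ← add_mul] at h0
  exact h0.tsum_eq.symm

lemma lt_two_pow_clog_of_not_pow_two {m : ℕ} (hnp : ¬ ∃ β : ℕ, m = 2 ^ β) :
    m < 2 ^ Nat.clog 2 m :=
  (Nat.le_pow_clog one_lt_two m).lt_of_ne fun h => hnp ⟨_, h⟩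

/-- contribution of the negative residuals to the average code-length
when `m` is not a power of 2, with `N = 2^⌈log₂ m⌉ − m`. -/
theorem neg_side_not_pow_two (θ : ℝ) (hθ : θ ∈ Set.Ioo (0:ℝ) 1)
    (m : ℕ) (hm : 0 < m) (hnp : ¬ ∃ β : ℕ, m = 2 ^ β)
    (ρ τ : ℕ) (hρ : 0 < ρ) (hτ : 0 < τ) (hρτ : ρ ≤ τ)
    (N : ℕ) (hN : N = 2 ^ Nat.clog 2 m - m) (δ : ℝ) (hδ : δ = (ρ : ℝ) / (2 * τ)) :
    ∫ ε in Set.Iic (0:ℝ), ((if 2 * |ε + δ| < (N : ℝ) then 1 + (Nat.log 2 m : ℝ)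
          else 2 + (Nat.log 2 m : ℝ) + (⌊(2 * |ε + δ| - (N : ℝ)) / (m : ℝ)⌋ : ℝ)) *
        ((-Real.log θ / 2) * θ ^ |ε|))
      = (1/2) * (1 + (Nat.log 2 m : ℝ)) +
        (1/2) * (θ ^ ((N : ℝ)/2) / (1 - θ ^ ((m : ℝ)/2))) * θ ^ δ := by
  have hN_one : (1 : ℝ) ≤ N := by
    have := lt_two_pow_clog_of_not_pow_two hnp
    exact_mod_cast (by omega : 1 ≤ N)
  have hm' : (0 : ℝ) < m := by exact_mod_cast hm
  have hδ_nonneg : 0 ≤ δ := by rw [hδ]; positivity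
  have hδ_le : 2 * δ ≤ 1 := by
    have hτ' : (0 : ℝ) < τ := by exact_mod_cast hτ
    have hρτ' : (ρ : ℝ) ≤ τ := by exact_mod_cast hρτ
    rw [hδ, ← mul_div_assoc, div_le_one (by positivity)]
    linarith
  have key := integral_step_mul_laplace hθ (1 + (Nat.log 2 m : ℝ)) (by positivity)
    (a := δ + N / 2) (d := m / 2) (by positivity) (by positivity)
  rw [← neg_zero, ← integral_comp_neg_Iic, integral_Iic_eq_integral_Iio] at key
  simp only [neg_zero] at key
  rw [integral_Iic_eq_integral_Iio]
  convert key using 1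
  · refine setIntegral_congr_fun measurableSet_Iio fun ε hε => ?_
    have hε' : ε < 0 := hε
    have hquot : (-ε - (δ + N / 2)) / ((m : ℝ) / 2) = (2 * (-ε - δ) - N) / m := by
      field_simp
      ring
    simp only [hquot, div_lt_iff₀ hm', zero_mul, sub_neg, abs_of_neg hε']
    congr 1
    rcases le_total 0 (-ε - δ) with h | h
    · rw [abs_of_nonpos (by linarith : ε + δ ≤ 0), neg_add']
      split_ifs <;> ring
    · rw [if_pos, if_pos, add_zero]
      · linarith
      · rw [abs_of_nonneg (by linarith)]
        linarith
  · rw [Real.rpow_add hθ.1]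
    ring
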